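/- Let n ≥ 3, 0 ≤ μ < (1 + n/(n-2))⁻², F(x) = x⟨x⟩^{-μ}, and A_F = ½(p·F(q) + F(q)·p). Then for every f ∈ C_c^∞(ℝⁿ), the commutator form ⟨f, [Δ, iA_F] f⟩ := i(⟨Δf, A_F f⟩ - ⟨A_F f, Δf⟩) satisfies ⟨f, [Δ, iA_F] f⟩ ≥ 2(1 - μ(1 + n/(n-2))²) ‖∇(⟨·⟩^{-μ/2} f)‖²_{L²} ≥ 0. In particular the form [Δ, iA_F] is nonnegative on C_c^∞(ℝⁿ). -/

import Mathlib

open MeasureTheory Complex Real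
open scoped ENNReal NNReal

noncomputable section

/-- `ℝⁿ` as a Euclidean space. -/
abbrev Ec (n : ℕ) := EuclideanSpace ℝ (Fin n)

/-- The `i`-th standard basis vector of `ℝⁿ`. -/
def eb (n : ℕ) (i : Fin n) : Ec n := EuclideanSpace.single i (1 : ℝ)

/-- The *nonnegative* Laplacian `Δ f = -∑ ∂²_i f`. -/
def lap {n : ℕ} (f : Ec n → ℂ) (x : Ec n) : ℂ :=
  -∑ i : Fin n, fderiv ℝ (fun y => fderiv ℝ f y (eb n i)) x (eb n i)

/-- The Japanese bracket `⟨x⟩ = (1+|x|²)^{1/2}`. -/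
def jap {n : ℕ} (x : Ec n) : ℝ := Real.sqrt (1 + ‖x‖ ^ 2)

/-- The vector field `F(x) = x⟨x⟩^{-μ}`. -/
def Fmu {n : ℕ} (μ : ℝ) (x : Ec n) : Ec n := (jap x ^ (-μ)) • x

/-- The divergence of `F(x) = x⟨x⟩^{-μ}`. -/
def divFmu {n : ℕ} (μ : ℝ) (x : Ec n) : ℝ :=
  ∑ i : Fin n, fderiv ℝ (fun y : Ec n => jap y ^ (-μ) * y i) x (eb n i)

/-- `A_F f = -i(F·∇f + ½(div F) f)` with `F(x) = x⟨x⟩^{-μ}`. -/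
def AF {n : ℕ} (μ : ℝ) (f : Ec n → ℂ) (x : Ec n) : ℂ :=
  -Complex.I * (fderiv ℝ f x (Fmu μ x) + (1 / 2 : ℂ) * (divFmu μ x : ℂ) * f x)


/-- `f` is differentiable at `x` with `i`-th partial derivative `d`. -/
def PD {n : ℕ} (i : Fin n) (f : Ec n → ℝ) (x : Ec n) (d : ℝ) : Prop :=
  DifferentiableAt ℝ f x ∧ fderiv ℝ f x (eb n i) = d

namespace PD
variable {n : ℕ} {i : Fin n} {f g : Ec n → ℝ} {x : Ec n} {d e : ℝ}

lemma mul (hf : PD i f x d) (hg : PD i g x e) :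
    PD i (fun y => f y * g y) x (d * g x + f x * e) := by
  refine ⟨hf.1.mul hg.1, ?_⟩
  rw [fderiv_fun_mul hf.1 hg.1]
  simp [hf.2, hg.2]
  ring

lemma add (hf : PD i f x d) (hg : PD i g x e) : PD i (fun y => f y + g y) x (d + e) := by
  refine ⟨hf.1.add hg.1, ?_⟩
  rw [fderiv_fun_add hf.1 hg.1]
  simp [hf.2, hg.2]

lemma const (c : ℝ) : PD i (fun _ => c) x 0 := by
  refine ⟨differentiableAt_const c, ?_⟩
  simp

lemma coord (k : Fin n) : PD i (fun y : Ec n => y k) x (if i = k then 1 else 0) := by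
  have h : HasFDerivAt (fun y : Ec n => y k) (EuclideanSpace.proj k : Ec n →L[ℝ] ℝ) x :=
    (EuclideanSpace.proj k : Ec n →L[ℝ] ℝ).hasFDerivAt
  refine ⟨h.differentiableAt, ?_⟩
  rw [h.fderiv]
  simp [eb, eq_comm]

lemma sum {F : Fin n → Ec n → ℝ} {D : Fin n → ℝ} (h : ∀ k, PD i (F k) x (D k)) :
    PD i (fun y => ∑ k, F k y) x (∑ k, D k) := by
  refine ⟨DifferentiableAt.fun_sum fun k _ => (h k).1, ?_⟩
  rw [fderiv_fun_sum fun k _ => (h k).1]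
  simp [fun k => (h k).2]

lemma congr (hf : PD i f x d) (h : d = e) : PD i f x e := h ▸ hf

lemma jp (s : ℝ) : PD i (fun y : Ec n => jap y ^ s) x (s * x i * (1 + ‖x‖ ^ 2)⁻¹ * jap x ^ s) := by
  have h0 : ∀ y : Ec n, 0 < 1 + ‖y‖ ^ 2 := fun y => by positivity
  have hfe : (fun y : Ec n => jap y ^ s) = fun y => (1 + ‖y‖ ^ 2) ^ (s / 2) := by
    funext y
    rw [jap, Real.sqrt_eq_rpow, ← Real.rpow_mul (h0 y).le]
    ring_nf
  have h1 : HasFDerivAt (fun y : Ec n => 1 + ‖y‖ ^ 2) (2 • (innerSL ℝ x)) x :=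
    (hasStrictFDerivAt_norm_sq x).hasFDerivAt.const_add 1
  have h2 := h1.rpow_const (p := s / 2) (Or.inl (h0 x).ne')
  have e1 : jap x ^ s = (1 + ‖x‖ ^ 2) ^ (s / 2) := congrFun hfe x
  rw [e1, hfe]
  refine ⟨h2.differentiableAt, ?_⟩
  rw [h2.fderiv, Real.rpow_sub_one (h0 x).ne']
  simp [eb, EuclideanSpace.inner_single_right]
  ring

lemma aa : PD i (fun y : Ec n => (1 + ‖y‖ ^ 2)⁻¹) x (-2 * x i * ((1 + ‖x‖ ^ 2)⁻¹) ^ 2) := by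
  have hx : ∀ y : Ec n, (1 + ‖y‖ ^ 2)⁻¹ = jap y ^ (-2 : ℝ) := by
    intro y
    have h0 : 0 < 1 + ‖y‖ ^ 2 := by positivity
    rw [jap, Real.rpow_neg (Real.sqrt_nonneg _)]
    norm_num [Real.sq_sqrt h0.le]
  have := jp (i := i) (x := x) (-2)
  rw [← hx] at this
  simp_rw [← hx] at this
  exact this.congr (by ring)
end PD

lemma jap_pos' {n : ℕ} (x : Ec n) : 0 < jap x := Real.sqrt_pos.2 (by positivity)

lemma contDiff_jap {n : ℕ} (s : ℝ) : ContDiff ℝ (⊤ : ℕ∞) (fun y : Ec n => jap y ^ s) := by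
  have : ContDiff ℝ (⊤ : ℕ∞) (fun y : Ec n => jap y) := by
    unfold jap
    exact (contDiff_const.add (contDiff_norm_sq ℝ)).sqrt (fun x => by positivity)
  exact this.rpow_const_of_ne (fun x => (jap_pos' x).ne')

lemma contDiff_a {n : ℕ} : ContDiff ℝ (⊤ : ℕ∞) (fun y : Ec n => (1 + ‖y‖ ^ 2)⁻¹) :=
  (contDiff_const.add (contDiff_norm_sq ℝ)).inv (fun x => by positivity)

lemma sum_sq {n : ℕ} (x : Ec n) : ∑ k, x k * x k = ‖x‖ ^ 2 := by
  rw [EuclideanSpace.norm_sq_eq]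
  simp [sq]

lemma divFmu_eq {n : ℕ} (μ : ℝ) (x : Ec n) :
    divFmu μ x = jap x ^ (-μ) * (n - μ + μ * (1 + ‖x‖ ^ 2)⁻¹) := by
  have h : ∀ i, fderiv ℝ (fun y : Ec n => jap y ^ (-μ) * y i) x (eb n i)
      = (-μ * (1 + ‖x‖ ^ 2)⁻¹ * jap x ^ (-μ)) * (x i * x i) + jap x ^ (-μ) := by
    intro i
    rw [((PD.jp (i := i) (x := x) (-μ)).mul (PD.coord i)).2]
    simp
    ring
  unfold divFmu
  simp_rw [h]
  rw [Finset.sum_add_distrib, ← Finset.mul_sum, sum_sq]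
  simp
  have h0 : 1 + ‖x‖ ^ 2 ≠ 0 := by positivity
  field_simp
  ring

/-- partial derivative -/
def pd {n : ℕ} (u : Ec n → ℝ) (i : Fin n) (x : Ec n) : ℝ := fderiv ℝ u x (eb n i)

lemma pd_contDiff {n : ℕ} {u : Ec n → ℝ} (hu : ContDiff ℝ (⊤ : ℕ∞) u) (i : Fin n) :
    ContDiff ℝ (⊤ : ℕ∞) (pd u i) :=
  (hu.fderiv_right (m := (⊤ : ℕ∞)) (by simp)).clm_apply contDiff_const

lemma pd_PD {n : ℕ} {u : Ec n → ℝ} (hu : ContDiff ℝ (⊤ : ℕ∞) u) (i : Fin n) (x : Ec n) :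
    PD i u x (pd u i x) :=
  ⟨(hu.differentiable (by simp)) x, rfl⟩

lemma pd_symm {n : ℕ} {u : Ec n → ℝ} (hu : ContDiff ℝ (⊤ : ℕ∞) u) (i k : Fin n) (x : Ec n) :
    pd (pd u k) i x = pd (pd u i) k x := by
  have hs : IsSymmSndFDerivAt ℝ u x := by
    apply ContDiffAt.isSymmSndFDerivAt (n := 2)
    · exact (contDiff_infty.1 hu 2).contDiffAt
    · simp
  have hd : DifferentiableAt ℝ (fderiv ℝ u) x :=
    ((hu.fderiv_right (m := (⊤ : ℕ∞)) (by simp)).differentiable (by simp)) x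
  have key : ∀ i k, pd (pd u k) i x = fderiv ℝ (fderiv ℝ u) x (eb n i) (eb n k) := by
    intro i k
    unfold pd
    rw [fderiv_clm_apply hd (differentiableAt_const _)]
    simp
  rw [key, key]
  exact hs _ _

lemma tsupport_pd {n : ℕ} {u : Ec n → ℝ} (i : Fin n) : tsupport (pd u i) ⊆ tsupport u :=
  (tsupport_fderiv_apply_subset ℝ (eb n i))

lemma int_pd {n : ℕ} {V : Ec n → ℝ} (hV : ContDiff ℝ (⊤ : ℕ∞) V) (hc : HasCompactSupport V)
    (i : Fin n) : Integrable (pd V i) ∧ ∫ x, pd V i x = 0 := by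
  have hi : Integrable (pd V i) :=
    (pd_contDiff hV i).continuous.integrable_of_hasCompactSupport
      (hc.fderiv_apply (𝕜 := ℝ) (eb n i))
  refine ⟨hi, ?_⟩
  have hi' : Integrable (fun x => fderiv ℝ V x (eb n i)) := hi
  have := integral_mul_fderiv_eq_neg_fderiv_mul_of_integrable (𝕜 := ℝ) (μ := (volume : Measure (Ec n)))
    (f := fun _ : Ec n => (1:ℝ)) (g := V) (v := eb n i) (by simp)
    (by simpa using hi') (by simpa using hV.continuous.integrable_of_hasCompactSupport hc)
    (fun _ _ => differentiableAt_const _) (fun x _ => (hV.differentiable (by simp)) x)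
  simpa [pd] using this

/-- The radial derivative. -/
def Sf {n : ℕ} (u : Ec n → ℝ) (x : Ec n) : ℝ := ∑ k, x k * pd u k x
/-- The gradient squared. -/
def Qf {n : ℕ} (u : Ec n → ℝ) (x : Ec n) : ℝ := ∑ k, pd u k x * pd u k x
/-- The sum of second derivatives. -/
def Lf {n : ℕ} (u : Ec n → ℝ) (x : Ec n) : ℝ := ∑ k, pd (pd u k) k x

/-- The vector field whose divergence is subtracted. -/
def Vf {n : ℕ} (μ : ℝ) (u : Ec n → ℝ) (i : Fin n) (x : Ec n) : ℝ :=
  jap x ^ (-μ) * (-2 * (pd u i x * Sf u x) + x i * Qf u x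
    + -1 * ((n - μ + μ * (1 + ‖x‖ ^ 2)⁻¹) * (u x * pd u i x))
    + x i * (((-μ * (n - μ) / 2 + μ - μ ^ 2) * (1 + ‖x‖ ^ 2)⁻¹
      + (μ ^ 2 / 2 - μ) * ((1 + ‖x‖ ^ 2)⁻¹ * (1 + ‖x‖ ^ 2)⁻¹)) * (u x * u x)))

lemma contDiff_coord {n : ℕ} (k : Fin n) : ContDiff ℝ (⊤ : ℕ∞) (fun y : Ec n => y k) :=
  (EuclideanSpace.proj k : Ec n →L[ℝ] ℝ).contDiff


lemma Sf_contDiff {n : ℕ} {u : Ec n → ℝ} (hu : ContDiff ℝ (⊤ : ℕ∞) u) : ContDiff ℝ (⊤ : ℕ∞) (Sf u) :=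
  ContDiff.sum fun k _ => (contDiff_coord k).mul (pd_contDiff hu k)
lemma Qf_contDiff {n : ℕ} {u : Ec n → ℝ} (hu : ContDiff ℝ (⊤ : ℕ∞) u) : ContDiff ℝ (⊤ : ℕ∞) (Qf u) :=
  ContDiff.sum fun k _ => (pd_contDiff hu k).mul (pd_contDiff hu k)
lemma Lf_contDiff {n : ℕ} {u : Ec n → ℝ} (hu : ContDiff ℝ (⊤ : ℕ∞) u) : ContDiff ℝ (⊤ : ℕ∞) (Lf u) :=
  ContDiff.sum fun k _ => (pd_contDiff (pd_contDiff hu k) k)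

lemma Vf_contDiff {n : ℕ} {u : Ec n → ℝ} (hu : ContDiff ℝ (⊤ : ℕ∞) u) (μ : ℝ) (i : Fin n) : ContDiff ℝ (⊤ : ℕ∞) (Vf μ u i) := by
  have h1 := Sf_contDiff hu
  have h2 := Qf_contDiff hu
  have h3 := pd_contDiff hu i
  have h4 := contDiff_a (n := n)
  have h5 := contDiff_jap (n := n) (-μ)
  have h6 := contDiff_coord i
  exact h5.mul ((((contDiff_const.mul (h3.mul h1)).add (h6.mul h2)).add
    (contDiff_const.mul ((contDiff_const.add (contDiff_const.mul h4)).mul (hu.mul h3)))).add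
    (h6.mul (((contDiff_const.mul h4).add (contDiff_const.mul (h4.mul h4))).mul (hu.mul hu))))

lemma Sf_PD {n : ℕ} {u : Ec n → ℝ} (hu : ContDiff ℝ (⊤ : ℕ∞) u) (i : Fin n) (x : Ec n) :
    PD i (Sf u) x (pd u i x + ∑ k, x k * pd (pd u k) i x) := by
  refine (PD.sum fun k => (PD.coord k).mul (pd_PD (pd_contDiff hu k) i x)).congr ?_
  rw [Finset.sum_add_distrib]
  simp

lemma Qf_PD {n : ℕ} {u : Ec n → ℝ} (hu : ContDiff ℝ (⊤ : ℕ∞) u) (i : Fin n) (x : Ec n) :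
    PD i (Qf u) x (2 * ∑ k, pd u k x * pd (pd u k) i x) := by
  refine (PD.sum fun k => (pd_PD (pd_contDiff hu k) i x).mul (pd_PD (pd_contDiff hu k) i x)).congr ?_
  rw [Finset.mul_sum]
  exact Finset.sum_congr rfl fun k _ => by ring

lemma divV {n : ℕ} {u : Ec n → ℝ} (hu : ContDiff ℝ (⊤ : ℕ∞) u) (μ : ℝ) (x : Ec n) (w a r : ℝ) (hw : w = jap x ^ (-μ)) (ha : a = (1 + ‖x‖ ^ 2)⁻¹)
    (hr : r = ‖x‖ ^ 2) :
    ∑ i, pd (Vf μ u i) i x =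
    w * (-2 * (Lf u x * Sf u x + Qf u x) + n * Qf u x
      + -1 * ((n - μ + μ * a) * (Qf u x + u x * Lf u x) + -2 * μ * a ^ 2 * u x * Sf u x)
      + ((-μ * (n - μ) / 2 + μ - μ ^ 2) * a + (μ ^ 2 / 2 - μ) * a ^ 2)
          * (n * u x ^ 2 + 2 * u x * Sf u x)
      + ((-μ * (n - μ) / 2 + μ - μ ^ 2) * (-2 * a ^ 2) + (μ ^ 2 / 2 - μ) * (-4 * a ^ 3))
          * r * u x ^ 2)
    - μ * a * w * (-2 * Sf u x ^ 2 + r * Qf u x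
      - (n - μ + μ * a) * u x * Sf u x
      + ((-μ * (n - μ) / 2 + μ - μ ^ 2) * a + (μ ^ 2 / 2 - μ) * a ^ 2) * r * u x ^ 2) := by
  set M := ∑ i, pd u i x * ∑ k, x k * pd (pd u k) i x with hM
  have hM' : ∑ i, x i * ∑ k, pd u k x * pd (pd u k) i x = M := by
    rw [hM]
    simp_rw [Finset.mul_sum]
    rw [Finset.sum_comm]
    refine Finset.sum_congr rfl fun i _ => Finset.sum_congr rfl fun k _ => ?_
    rw [pd_symm hu i k]
    ring
  have key : ∀ i, pd (Vf μ u i) i x =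
      (w * (Qf u x) + w * ((-μ * (n - μ) / 2 + μ - μ ^ 2) * a + (μ ^ 2 / 2 - μ) * a ^ 2) * u x ^ 2) * 1
      + (-2 * w * Sf u x - w * (n - μ + μ * a) * u x) * pd (pd u i) i x
      + (-2 * w - w * (n - μ + μ * a)) * (pd u i x * pd u i x)
      + (-2 * w) * (pd u i x * ∑ k, x k * pd (pd u k) i x)
      + (2 * w) * (x i * ∑ k, pd u k x * pd (pd u k) i x)
      + (2 * μ * a * w * Sf u x + 2 * μ * a ^ 2 * w * u x + μ * a * w * (n - μ + μ * a) * u x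
          + w * ((-μ * (n - μ) / 2 + μ - μ ^ 2) * a + (μ ^ 2 / 2 - μ) * a ^ 2) * 2 * u x)
          * (x i * pd u i x)
      + (-μ * a * w * Qf u x
          - μ * a * w * ((-μ * (n - μ) / 2 + μ - μ ^ 2) * a + (μ ^ 2 / 2 - μ) * a ^ 2) * u x ^ 2
          + w * ((-μ * (n - μ) / 2 + μ - μ ^ 2) * (-2 * a ^ 2) + (μ ^ 2 / 2 - μ) * (-4 * a ^ 3))
            * u x ^ 2) * (x i * x i) := by
    intro i
    have h1 := Sf_PD hu i x
    have h2 := Qf_PD hu i x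
    have h3 := pd_PD (pd_contDiff hu i) i x
    have h4 := PD.aa (n := n) (i := i) (x := x)
    have h5 := PD.jp (n := n) (i := i) (x := x) (-μ)
    have h6 := PD.coord (i := i) (x := x) i
    have h7 := pd_PD hu i x
    have := h5.mul (((((PD.const (-2)).mul (h3.mul h1)).add (h6.mul h2)).add
      ((PD.const (-1)).mul (((PD.const (n - μ)).add ((PD.const μ).mul h4)).mul (h7.mul h3)))).add
      (h6.mul ((((PD.const (-μ * (n - μ) / 2 + μ - μ ^ 2)).mul h4).add
        ((PD.const (μ ^ 2 / 2 - μ)).mul (h4.mul h4))).mul (h7.mul h7))))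
    have e := this.2
    rw [← ha, ← hw] at e
    refine (show pd (Vf μ u i) i x = _ from e).trans ?_
    simp only [if_true]
    ring
  simp_rw [key]
  simp only [Finset.sum_add_distrib, ← Finset.mul_sum]
  rw [hM', ← hM, sum_sq, ← hr]
  rw [show ∑ k, pd (pd u k) k x = Lf u x from rfl, show ∑ k, x k * pd u k x = Sf u x from rfl,
    show ∑ k, pd u k x * pd u k x = Qf u x from rfl]
  simp only [Finset.sum_const, Finset.card_univ, Fintype.card_fin, nsmul_eq_mul]
  ring

lemma pd_g {n : ℕ} {u : Ec n → ℝ} (hu : ContDiff ℝ (⊤ : ℕ∞) u) (μ : ℝ) (x : Ec n) (i : Fin n) :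
    pd (fun y => jap y ^ (-(μ / 2)) * u y) i x =
      jap x ^ (-(μ / 2)) * (pd u i x - μ / 2 * (1 + ‖x‖ ^ 2)⁻¹ * u x * x i) := by
  have := ((PD.jp (n := n) (i := i) (x := x) (-(μ / 2))).mul (pd_PD hu i x)).2
  refine (show _ = _ from this).trans ?_
  ring

lemma Qg {n : ℕ} {u : Ec n → ℝ} (hu : ContDiff ℝ (⊤ : ℕ∞) u) (μ : ℝ) (x : Ec n) :
    Qf (fun y => jap y ^ (-(μ / 2)) * u y) x = jap x ^ (-μ) *
      (∑ i, (pd u i x - μ / 2 * (1 + ‖x‖ ^ 2)⁻¹ * u x * x i) ^ 2) := by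
  unfold Qf
  simp_rw [pd_g hu]
  have : jap x ^ (-μ) = jap x ^ (-(μ / 2)) * jap x ^ (-(μ / 2)) := by
    rw [← Real.rpow_add (jap_pos' x)]
    ring_nf
  rw [this, Finset.mul_sum]
  exact Finset.sum_congr rfl fun k _ => by ring

lemma pointwise {n : ℕ} {u : Ec n → ℝ} (hu : ContDiff ℝ (⊤ : ℕ∞) u) (hn : 3 ≤ n) (μ : ℝ) (h0 : 0 ≤ μ) (h1 : μ ≤ 1) (x : Ec n) :
    2 * (1 - μ) * Qf (fun y => jap y ^ (-(μ / 2)) * u y) x + ∑ i, pd (Vf μ u i) i x ≤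
    -2 * (Lf u x * (jap x ^ (-μ) * Sf u x
      + 1 / 2 * (jap x ^ (-μ) * (n - μ + μ * (1 + ‖x‖ ^ 2)⁻¹)) * u x)) := by
  have hd := divV hu μ x _ _ _ rfl rfl rfl
  rw [hd, Qg hu]
  have hw : 0 < jap x ^ (-μ) := Real.rpow_pos_of_pos (jap_pos' x) _
  have ha0 : 0 < (1 + ‖x‖ ^ 2)⁻¹ := by positivity
  have har : (1 + ‖x‖ ^ 2)⁻¹ * ‖x‖ ^ 2 = 1 - (1 + ‖x‖ ^ 2)⁻¹ := by
    have : 1 + ‖x‖ ^ 2 ≠ 0 := by positivity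
    field_simp
    ring
  have hr0 : 0 ≤ ‖x‖ ^ 2 := by positivity
  have hn' : (3 : ℝ) ≤ n := by exact_mod_cast hn
  have hcs := Finset.sum_mul_sq_le_sq_mul_sq Finset.univ (fun i => x i)
    (fun i => pd u i x - μ / 2 * (1 + ‖x‖ ^ 2)⁻¹ * u x * x i)
  have e1 : ∑ i, x i ^ 2 = ‖x‖ ^ 2 := by
    rw [← sum_sq]
    exact Finset.sum_congr rfl fun k _ => by ring
  have e2 : ∑ i, x i * (pd u i x - μ / 2 * (1 + ‖x‖ ^ 2)⁻¹ * u x * x i)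
      = Sf u x - μ / 2 * (1 + ‖x‖ ^ 2)⁻¹ * u x * ‖x‖ ^ 2 := by
    rw [← sum_sq, Sf, Finset.mul_sum, ← Finset.sum_sub_distrib]
    exact Finset.sum_congr rfl fun k _ => by ring
  have e3 : ∑ i, (pd u i x - μ / 2 * (1 + ‖x‖ ^ 2)⁻¹ * u x * x i) ^ 2
      = Qf u x - μ * (1 + ‖x‖ ^ 2)⁻¹ * u x * Sf u x
        + (μ / 2 * (1 + ‖x‖ ^ 2)⁻¹ * u x) ^ 2 * ‖x‖ ^ 2 := by
    rw [← sum_sq, Sf, Qf, Finset.mul_sum, Finset.mul_sum, ← Finset.sum_sub_distrib,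
      ← Finset.sum_add_distrib]
    exact Finset.sum_congr rfl fun k _ => by ring
  have hP : 0 ≤ ∑ i, (pd u i x - μ / 2 * (1 + ‖x‖ ^ 2)⁻¹ * u x * x i) ^ 2 :=
    Finset.sum_nonneg fun i _ => sq_nonneg _
  rw [e1, e2, e3] at hcs
  rw [e3] at hP ⊢
  generalize (1 + ‖x‖ ^ 2)⁻¹ = a at *
  generalize ‖x‖ ^ 2 = r at *
  generalize jap x ^ (-μ) = w at *
  generalize Sf u x = S at *
  generalize Qf u x = Q at *
  generalize Lf u x = l at *
  generalize u x = t at *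
  have hm : a * (S - μ / 2 * a * t * r) ^ 2 ≤
      Q - μ * a * t * S + (μ / 2 * a * t) ^ 2 * r := by nlinarith
  have hZ : 0 ≤ (((n : ℝ) - 2) ^ 2 / 2 - μ / 2) * a + (2 * n - 6 + 3 / 2 * μ) * a ^ 2
      + (4 - μ) * a ^ 3 := by
    have : 0 ≤ ((n : ℝ) - 2) ^ 2 / 2 - μ / 2 := by nlinarith
    have : 0 ≤ 2 * (n : ℝ) - 6 + 3 / 2 * μ := by nlinarith
    have : 0 ≤ 4 - μ := by linarith
    positivity
  have hR : 0 ≤ w * μ * (2 * (Q - μ * a * t * S + (μ / 2 * a * t) ^ 2 * r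
      - a * (S - μ / 2 * a * t * r) ^ 2)
      + ((((n : ℝ) - 2) ^ 2 / 2 - μ / 2) * a + (2 * n - 6 + 3 / 2 * μ) * a ^ 2
      + (4 - μ) * a ^ 3) * t ^ 2) := by
    have : 0 ≤ Q - μ * a * t * S + (μ / 2 * a * t) ^ 2 * r - a * (S - μ / 2 * a * t * r) ^ 2 := by
      linarith
    positivity
  rw [← sub_nonneg]
  refine hR.trans_eq ?_
  have hr1 : r = (1 - a) / a := by
    rw [eq_div_iff ha0.ne']
    linarith
  rw [hr1]
  field_simp
  ring

lemma supp_zero {n : ℕ} {u : Ec n → ℝ} {x : Ec n} (hx : x ∉ tsupport u) :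
    u x = 0 ∧ (∀ i, pd u i x = 0) ∧ ∀ i k, pd (pd u i) k x = 0 := by
  have h1 : ∀ i, x ∉ tsupport (pd u i) := fun i h => hx (tsupport_pd i h)
  refine ⟨image_eq_zero_of_notMem_tsupport hx, fun i => image_eq_zero_of_notMem_tsupport (h1 i),
    fun i k => image_eq_zero_of_notMem_tsupport fun h => h1 i (tsupport_pd k h)⟩

/-- The commutator density. -/
def Gf {n : ℕ} (μ : ℝ) (u : Ec n → ℝ) (x : Ec n) : ℝ :=
  -2 * (Lf u x * (jap x ^ (-μ) * Sf u x
      + 1 / 2 * (jap x ^ (-μ) * (n - μ + μ * (1 + ‖x‖ ^ 2)⁻¹)) * u x))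

lemma real_main {n : ℕ} {u : Ec n → ℝ} (hu : ContDiff ℝ (⊤ : ℕ∞) u) (hc : HasCompactSupport u)
    (hn : 3 ≤ n) (μ : ℝ) (h0 : 0 ≤ μ) (h1 : μ ≤ 1) :
    Integrable (Gf μ u) ∧ Integrable (Qf (fun y => jap y ^ (-(μ / 2)) * u y)) ∧
    2 * (1 - μ) * ∫ x, Qf (fun y => jap y ^ (-(μ / 2)) * u y) x ≤ ∫ x, Gf μ u x := by
  have iG : Integrable (Gf μ u) := by
    apply Continuous.integrable_of_hasCompactSupport
    · have h1 := (Sf_contDiff hu).continuous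
      have h2 := (Lf_contDiff hu).continuous
      have h4 := (contDiff_a (n := n)).continuous
      have h5 := (contDiff_jap (n := n) (-μ)).continuous
      have h6 := hu.continuous
      unfold Gf
      fun_prop
    · refine HasCompactSupport.intro hc fun x hx => ?_
      obtain ⟨a, b, c⟩ := supp_zero hx
      simp [Gf, Lf, c]
  have iQ : Integrable (Qf (fun y => jap y ^ (-(μ / 2)) * u y)) := by
    apply Continuous.integrable_of_hasCompactSupport
    · exact (Qf_contDiff ((contDiff_jap (n := n) (-(μ / 2))).mul hu)).continuous
    · refine HasCompactSupport.intro hc fun x hx => ?_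
      obtain ⟨a, b, c⟩ := supp_zero hx
      rw [Qg hu]
      simp [a, b]
  have hV : ∀ i, Integrable (pd (Vf μ u i) i) ∧ ∫ x, pd (Vf μ u i) i x = 0 := by
    intro i
    refine int_pd (Vf_contDiff hu μ i) ?_ i
    refine HasCompactSupport.intro hc fun x hx => ?_
    obtain ⟨a, b, c⟩ := supp_zero hx
    simp [Vf, Qf, a, b]
  refine ⟨iG, iQ, ?_⟩
  have hs : Integrable (fun x => ∑ i, pd (Vf μ u i) i x) :=
    integrable_finsetSum _ fun i _ => (hV i).1
  have := integral_mono ((iQ.const_mul (2 * (1 - μ))).add hs) iG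
    (fun x => pointwise hu hn μ h0 h1 x)
  have e := integral_add (iQ.const_mul (2 * (1 - μ))) hs
  simp only [Pi.add_apply] at this
  rw [e, integral_const_mul, integral_finsetSum _ fun i _ => (hV i).1] at this
  simpa [fun i => (hV i).2] using this

lemma pd_re {n : ℕ} {f : Ec n → ℂ} (hf : Differentiable ℝ f) (i : Fin n) (x : Ec n) :
    pd (fun y => (f y).re) i x = (fderiv ℝ f x (eb n i)).re ∧
    pd (fun y => (f y).im) i x = (fderiv ℝ f x (eb n i)).im := by
  constructor
  · have := (Complex.reCLM.hasFDerivAt (x := f x)).comp x (hf x).hasFDerivAt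
    unfold pd
    rw [show (fun y => (f y).re) = Complex.reCLM ∘ f from rfl, this.fderiv]
    rfl
  · have := (Complex.imCLM.hasFDerivAt (x := f x)).comp x (hf x).hasFDerivAt
    unfold pd
    rw [show (fun y => (f y).im) = Complex.imCLM ∘ f from rfl, this.fderiv]
    rfl

lemma vec_sum {n : ℕ} (x : Ec n) : x = ∑ k, x k • eb n k := by
  ext j
  simp [eb, Pi.single_apply]

/-- for `0 ≤ μ < (1+n/(n-2))⁻²` and `f ∈ C_c^∞(ℝⁿ)`, the commutator form
`⟨f,[Δ,iA_F]f⟩ = i(⟨Δf, A_F f⟩ - ⟨A_F f, Δf⟩)` satisfies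
`⟨f,[Δ,iA_F]f⟩ ≥ 2(1-μ(1+n/(n-2))²)‖∇(⟨·⟩^{-μ/2}f)‖² ≥ 0`. -/
theorem statement15 (n : ℕ) (hn : 3 ≤ n) (μ : ℝ) (hμ0 : 0 ≤ μ)
    (hμ : μ < ((1 + (n : ℝ) / ((n : ℝ) - 2)) ^ 2)⁻¹)
    (f : Ec n → ℂ) (hf : ContDiff ℝ (⊤ : ℕ∞) f) (hsupp : HasCompactSupport f) :
    2 * (1 - μ * (1 + (n : ℝ) / ((n : ℝ) - 2)) ^ 2) *
        (∫ x : Ec n, ∑ i : Fin n,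
          ‖fderiv ℝ (fun y => ((jap y ^ (-(μ / 2)) : ℝ) : ℂ) * f y) x (eb n i)‖ ^ 2) ≤
      (Complex.I * ((∫ x, (starRingEnd ℂ) (lap f x) * AF μ f x) -
        ∫ x, (starRingEnd ℂ) (AF μ f x) * lap f x)).re ∧
    0 ≤ 2 * (1 - μ * (1 + (n : ℝ) / ((n : ℝ) - 2)) ^ 2) *
        (∫ x : Ec n, ∑ i : Fin n,
          ‖fderiv ℝ (fun y => ((jap y ^ (-(μ / 2)) : ℝ) : ℂ) * f y) x (eb n i)‖ ^ 2) := by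

  have hf1 : Differentiable ℝ f := hf.differentiable (by simp)
  have hfd : ∀ i, ContDiff ℝ (⊤ : ℕ∞) (fun y => fderiv ℝ f y (eb n i)) := fun i =>
    (hf.fderiv_right (m := (⊤ : ℕ∞)) (by simp)).clm_apply contDiff_const
  have hfd1 : ∀ i, Differentiable ℝ (fun y => fderiv ℝ f y (eb n i)) := fun i =>
    (hfd i).differentiable (by simp)
  have hfdd : ∀ i, Continuous (fun x => fderiv ℝ (fun y => fderiv ℝ f y (eb n i)) x (eb n i)) :=
    fun i => (((hfd i).fderiv_right (m := (⊤ : ℕ∞)) (by simp)).clm_apply contDiff_const).continuous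
  set u : Ec n → ℝ := fun y => (f y).re with hu_def
  set v : Ec n → ℝ := fun y => (f y).im with hv_def
  have hu : ContDiff ℝ (⊤ : ℕ∞) u := Complex.reCLM.contDiff.comp hf
  have hv : ContDiff ℝ (⊤ : ℕ∞) v := Complex.imCLM.contDiff.comp hf
  have hcu : HasCompactSupport u := hsupp.comp_left (g := Complex.re) rfl
  have hcv : HasCompactSupport v := hsupp.comp_left (g := Complex.im) rfl
  have hn' : (3 : ℝ) ≤ n := by exact_mod_cast hn
  set C : ℝ := (1 + (n : ℝ) / ((n : ℝ) - 2)) ^ 2 with hC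
  have hC1 : 1 ≤ C := by
    have : 0 ≤ (n : ℝ) / ((n : ℝ) - 2) := div_nonneg (by linarith) (by linarith)
    rw [hC]
    nlinarith
  have hμC : μ * C < 1 := by
    rwa [← one_div, lt_div_iff₀ (by linarith)] at hμ
  have hμ1 : μ ≤ 1 := by nlinarith
  obtain ⟨iGu, iQu, mu⟩ := real_main hu hcu hn μ hμ0 hμ1
  obtain ⟨iGv, iQv, mv⟩ := real_main hv hcv hn μ hμ0 hμ1
  -- gradient term
  have hgrad : ∀ x : Ec n, ∑ i : Fin n,
      ‖fderiv ℝ (fun y => ((jap y ^ (-(μ / 2)) : ℝ) : ℂ) * f y) x (eb n i)‖ ^ 2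
      = Qf (fun y => jap y ^ (-(μ / 2)) * u y) x + Qf (fun y => jap y ^ (-(μ / 2)) * v y) x := by
    intro x
    have hg : Differentiable ℝ (fun y => ((jap y ^ (-(μ / 2)) : ℝ) : ℂ) * f y) :=
      ((Complex.ofRealCLM.contDiff.comp (contDiff_jap (n := n) (-(μ / 2)))).mul hf).differentiable
        (by simp)
    unfold Qf
    rw [← Finset.sum_add_distrib]
    refine Finset.sum_congr rfl fun i _ => ?_
    obtain ⟨e1, e2⟩ := pd_re hg i x
    rw [← Complex.normSq_eq_norm_sq, Complex.normSq_apply, ← e1, ← e2]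
    simp only [Complex.re_ofReal_mul, Complex.im_ofReal_mul, hu_def, hv_def]
  have hI : (∫ x : Ec n, ∑ i : Fin n,
      ‖fderiv ℝ (fun y => ((jap y ^ (-(μ / 2)) : ℝ) : ℂ) * f y) x (eb n i)‖ ^ 2)
      = (∫ x, Qf (fun y => jap y ^ (-(μ / 2)) * u y) x)
        + ∫ x, Qf (fun y => jap y ^ (-(μ / 2)) * v y) x := by
    simp_rw [hgrad]
    exact integral_add iQu iQv
  have hI0 : 0 ≤ ∫ x : Ec n, ∑ i : Fin n,
      ‖fderiv ℝ (fun y => ((jap y ^ (-(μ / 2)) : ℝ) : ℂ) * f y) x (eb n i)‖ ^ 2 :=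
    integral_nonneg fun x => Finset.sum_nonneg fun i _ => by positivity
  -- commutator term
  have hAF : ∀ x, AF μ f x = -Complex.I * (((jap x ^ (-μ) : ℝ) : ℂ) * (∑ k, ((x k : ℝ) : ℂ) * fderiv ℝ f x (eb n k))
      + (1 / 2 : ℂ) * ((jap x ^ (-μ) * (n - μ + μ * (1 + ‖x‖ ^ 2)⁻¹) : ℝ) : ℂ) * f x) := by
    intro x
    unfold AF
    rw [divFmu_eq, Fmu]
    congr 3
    rw [map_smul]
    conv_lhs => rw [vec_sum x]
    simp only [map_sum, map_smul, Complex.real_smul]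
    rw [← vec_sum x]
  have hre : ∀ x, (∑ k, ((x k : ℝ) : ℂ) * fderiv ℝ f x (eb n k)).re = Sf u x ∧
      (∑ k, ((x k : ℝ) : ℂ) * fderiv ℝ f x (eb n k)).im = Sf v x := by
    intro x
    rw [Complex.re_sum, Complex.im_sum]
    simp only [Complex.re_ofReal_mul, Complex.im_ofReal_mul]
    exact ⟨Finset.sum_congr rfl fun k _ => by rw [← (pd_re hf1 k x).1],
      Finset.sum_congr rfl fun k _ => by rw [← (pd_re hf1 k x).2]⟩
  have hlap : ∀ x, (lap f x).re = -Lf u x ∧ (lap f x).im = -Lf v x := by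
    intro x
    unfold lap
    rw [Complex.neg_re, Complex.neg_im, Complex.re_sum, Complex.im_sum]
    have e1 : ∀ k, pd u k = fun y => (fderiv ℝ f y (eb n k)).re := fun k =>
      funext fun y => (pd_re hf1 k y).1
    have e2 : ∀ k, pd v k = fun y => (fderiv ℝ f y (eb n k)).im := fun k =>
      funext fun y => (pd_re hf1 k y).2
    unfold Lf
    simp_rw [e1, e2]
    exact ⟨congrArg _ (Finset.sum_congr rfl fun k _ => by rw [← (pd_re (hfd1 k) k x).1]),
      congrArg _ (Finset.sum_congr rfl fun k _ => by rw [← (pd_re (hfd1 k) k x).2])⟩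
  have him : ∀ x, ((starRingEnd ℂ) (lap f x) * AF μ f x).im
      = -(1 / 2) * (Gf μ u x + Gf μ v x) := by
    intro x
    obtain ⟨a1, a2⟩ := hlap x
    obtain ⟨b1, b2⟩ := hre x
    rw [hAF, mul_assoc (1 / 2 : ℂ), show (1 / 2 : ℂ) = ((1 / 2 : ℝ) : ℂ) by push_cast; rfl]
    generalize (∑ k, ((x k : ℝ) : ℂ) * fderiv ℝ f x (eb n k)) = Y at *
    generalize lap f x = l at *
    simp only [Complex.mul_im, Complex.mul_re, Complex.conj_re, Complex.conj_im, Complex.neg_re,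
      Complex.neg_im, Complex.I_re, Complex.I_im, Complex.add_re, Complex.add_im,
      Complex.ofReal_re, Complex.ofReal_im, a1, a2, b1, b2, Gf, hu_def, hv_def]
    ring
  have hint : Integrable (fun x => (starRingEnd ℂ) (lap f x) * AF μ f x) := by
    apply Continuous.integrable_of_hasCompactSupport
    · have h4 := (contDiff_a (n := n)).continuous
      have h5 := (contDiff_jap (n := n) (-μ)).continuous
      have h6 := hf.continuous
      have h7 : ∀ i, Continuous (fun y => fderiv ℝ f y (eb n i)) := fun i => (hfd i).continuous
      have h8 : Continuous (lap f) := by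
        unfold lap
        exact (continuous_finsetSum _ fun i _ => hfdd i).neg
      have h9 : ∀ k, Continuous (fun y : Ec n => y k) := fun k => (contDiff_coord k).continuous
      simp_rw [hAF]
      refine (Complex.continuous_conj.comp h8).mul ?_
      fun_prop
    · refine HasCompactSupport.intro hsupp fun x hx => ?_
      have : AF μ f x = 0 := by
        have z1 : f x = 0 := image_eq_zero_of_notMem_tsupport hx
        have z2 : fderiv ℝ f x = 0 :=
          image_eq_zero_of_notMem_tsupport fun h => hx (tsupport_fderiv_subset ℝ h)
        simp [AF, z1, z2]
      rw [this, mul_zero]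
  have hcomm : (Complex.I * ((∫ x, (starRingEnd ℂ) (lap f x) * AF μ f x) -
        ∫ x, (starRingEnd ℂ) (AF μ f x) * lap f x)).re
      = (∫ x, Gf μ u x) + ∫ x, Gf μ v x := by
    have c1 : ∫ x, (starRingEnd ℂ) (AF μ f x) * lap f x
        = (starRingEnd ℂ) (∫ x, (starRingEnd ℂ) (lap f x) * AF μ f x) := by
      rw [← integral_conj]
      congr 1
      funext x
      simp [mul_comm]
    have c2 : (∫ x, (starRingEnd ℂ) (lap f x) * AF μ f x).im
        = -(1 / 2) * ((∫ x, Gf μ u x) + ∫ x, Gf μ v x) := by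
      rw [← integral_add iGu iGv, ← integral_const_mul]
      have := integral_im hint
      simp only [RCLike.im_to_complex] at this
      rw [← this]
      congr 1
      funext x
      exact him x
    rw [c1]
    simp only [Complex.mul_re, Complex.I_re, Complex.I_im, Complex.sub_im, Complex.conj_im, c2]
    ring
  have hnn : 0 ≤ 1 - μ * C := by linarith
  refine ⟨?_, mul_nonneg (by linarith) hI0⟩
  rw [hcomm]
  refine le_trans ?_ (add_le_add mu mv)
  rw [← mul_add, ← hI]
  exact mul_le_mul_of_nonneg_right (by nlinarith) hI0
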